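/- Let d ≥ 1, δ > 0, let w ≥ 1 be an integer, and let ε > 0 satisfy w · (1/(δ³√(2π))) e^{−δ²/2} ≤ ε. Draw (a₁,b₁), …, (a_w,b_w) independently, each distributed as (a, b) with the d coordinates of a i.i.d. standard normal N(0,1) and b uniform on (0, 2δ). Then for all s, q ∈ ℝ^d with ‖s − q‖ ≤ 1, the probability that for every i ∈ {1, …, w} the ternary hashes of s and q under (a_i, b_i) match is at least 1 − ε. (No false negative occurs with probability at least 1 − ε.) -/

import Mathlib

open MeasureTheory ProbabilityTheory Real
open scoped ENNReal

noncomputable section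

/-- Standard inner product on `Fin d → ℝ`. -/
def dotp {d : ℕ} (a x : Fin d → ℝ) : ℝ := ∑ i, a i * x i

/-- Euclidean norm on `Fin d → ℝ`. -/
def enorm' {d : ℕ} (x : Fin d → ℝ) : ℝ := Real.sqrt (∑ i, x i ^ 2)

/-- Ternary hash index `⌊(⟨a,p⟩ + b)/δ⌋ mod 4`. -/
def hashIdx {d : ℕ} (δ : ℝ) (a : Fin d → ℝ) (b : ℝ) (p : Fin d → ℝ) : ℤ :=
  ⌊(dotp a p + b) / δ⌋ % 4

/-- `s` and `q` mismatch: one hash index is 0 (ternary symbol `0`) and the other is 2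
(ternary symbol `1`). -/
def Mismatch {d : ℕ} (δ : ℝ) (a : Fin d → ℝ) (b : ℝ) (s q : Fin d → ℝ) : Prop :=
  (hashIdx δ a b s = 0 ∧ hashIdx δ a b q = 2) ∨ (hashIdx δ a b s = 2 ∧ hashIdx δ a b q = 0)

/-- Product of `d` i.i.d. standard Gaussians: the law of `a`. -/
def gaussPi (d : ℕ) : Measure (Fin d → ℝ) := Measure.pi fun _ => gaussianReal 0 1

/-- Uniform probability measure on the interval `(0, 2δ)`: the law of `b`. -/
def unifB (δ : ℝ) : Measure ℝ :=
  (ENNReal.ofReal (2 * δ))⁻¹ • volume.restrict (Set.Ioo 0 (2 * δ))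

/-- Joint law of the independent pair `(a, b)`. -/
def jointμ (d : ℕ) (δ : ℝ) : Measure ((Fin d → ℝ) × ℝ) := (gaussPi d).prod (unifB δ)

/-- Mismatch probability `Ψ̄(s,q)` over the random pair `(a, b)`. -/
def PsiBar (d : ℕ) (δ : ℝ) (s q : Fin d → ℝ) : ℝ≥0∞ :=
  jointμ d δ {ab : (Fin d → ℝ) × ℝ | Mismatch δ ab.1 ab.2 s q}

/-- Complementary cdf `F̄` of the standard normal distribution. -/
def Fbar (y : ℝ) : ℝ := ∫ t in Set.Ioi y, (1 / Real.sqrt (2 * π)) * Real.exp (-t ^ 2 / 2)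

/-- The function `φ(y) = e^{-y²/2}/(y√(2π)) - F̄(y)`. -/
def phi (y : ℝ) : ℝ := Real.exp (-y ^ 2 / 2) / (y * Real.sqrt (2 * π)) - Fbar y

/-- One-dimensional ternary hash index `⌊(u + b)/δ⌋ mod 4`. -/
def jb (δ b u : ℝ) : ℤ := ⌊(u + b) / δ⌋ % 4

/-- One-dimensional mismatch: one index is 0 and the other is 2. -/
def Mismatch1 (δ b u v : ℝ) : Prop :=
  (jb δ b u = 0 ∧ jb δ b v = 2) ∨ (jb δ b u = 2 ∧ jb δ b v = 0)

/-- One-dimensional mismatch probability `ψ̄(u,v)` over `b` uniform on `(0, 2δ)`. -/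
def psiBar (δ u v : ℝ) : ℝ≥0∞ := unifB δ {b | Mismatch1 δ b u v}

/-- A fixed linear functional of a standard Gaussian vector is a centered Gaussian whose standard
deviation is the Euclidean norm of the functional. -/
lemma map_dotp_gaussPi {d : ℕ} (x : Fin d → ℝ) :
    (gaussPi d).map (fun a => dotp a x) = (gaussianReal 0 1).map (fun z => enorm' x * z) := by
  have hm : Measurable fun a : Fin d → ℝ => dotp a x := by unfold dotp; fun_prop
  have : IsProbabilityMeasure (gaussPi d) := by unfold gaussPi; infer_instance
  have := Measure.isProbabilityMeasure_map (μ := gaussPi d) hm.aemeasurable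
  rw [gaussianReal_map_const_mul]
  apply Measure.ext_of_charFun
  ext t
  rw [charFun_gaussianReal, charFun_apply_real, integral_map hm.aemeasurable (by fun_prop)]
  have h1 : ∀ a : Fin d → ℝ, Complex.exp (t * (dotp a x : ℝ) * Complex.I)
      = ∏ i, Complex.exp ((t * x i : ℝ) * (a i : ℝ) * Complex.I) := by
    intro a
    rw [← Complex.exp_sum, dotp]
    push_cast
    rw [Finset.mul_sum, Finset.sum_mul]
    congr 1
    exact Finset.sum_congr rfl fun i _ => by ring
  simp_rw [h1]
  rw [gaussPi, integral_fintype_prod_eq_prod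
    (f := fun i (y : ℝ) => Complex.exp ((t * x i : ℝ) * (y : ℝ) * Complex.I))]
  simp_rw [← charFun_apply_real, charFun_gaussianReal]
  rw [← Complex.exp_sum]
  congr 1
  have h2 : enorm' x ^ 2 = ∑ i, x i ^ 2 := Real.sq_sqrt (by positivity)
  have h3 : (((NNReal.mk (enorm' x ^ 2) (sq_nonneg _) * 1 : NNReal) : ℝ) : ℂ) =
      ∑ i, (x i : ℂ) ^ 2 := by
    rw [mul_one, NNReal.coe_mk, h2]
    push_cast
    rfl
  rw [h3]
  push_cast
  simp only [mul_zero, zero_mul, zero_sub, one_mul]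
  rw [Finset.sum_mul, Finset.sum_div, ← Finset.sum_neg_distrib]
  exact Finset.sum_congr rfl fun i _ => by ring

lemma measurableSet_mismatch1 (δ u v : ℝ) : MeasurableSet {b | Mismatch1 δ b u v} := by
  have hj : ∀ u, Measurable fun b => jb δ b u := fun u =>
    (measurable_from_top (f := fun n : ℤ => n % 4)).comp
      (Int.measurable_floor.comp (by fun_prop : Measurable fun b : ℝ => (u + b) / δ))
  have hs : ∀ u (n : ℤ), MeasurableSet {b | jb δ b u = n} := fun u n =>
    hj u (measurableSet_singleton n)
  exact ((hs u 0).inter (hs v 2)).union ((hs u 2).inter (hs v 0))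

lemma measurableSet_mismatch {d : ℕ} (δ : ℝ) (s q : Fin d → ℝ) :
    MeasurableSet {ab : (Fin d → ℝ) × ℝ | Mismatch δ ab.1 ab.2 s q} := by
  have hj : ∀ p, Measurable fun ab : (Fin d → ℝ) × ℝ => hashIdx δ ab.1 ab.2 p := fun p => by
    refine (measurable_from_top (f := fun n : ℤ => n % 4)).comp (Int.measurable_floor.comp ?_)
    unfold dotp
    fun_prop
  have hs : ∀ p (n : ℤ), MeasurableSet {ab : (Fin d → ℝ) × ℝ | hashIdx δ ab.1 ab.2 p = n} :=
    fun p n => hj p (measurableSet_singleton n)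
  exact ((hs s 0).inter (hs q 2)).union ((hs s 2).inter (hs q 0))

lemma Mismatch1.symm {δ b u v : ℝ} (h : Mismatch1 δ b u v) : Mismatch1 δ b v u :=
  h.elim (fun h => .inr h.symm) (fun h => .inl h.symm)

/-- Translating by two cells exchanges the ternary symbols `0` and `1`. -/
lemma mismatch1_add_zsmul {δ : ℝ} (hδ : 0 < δ) (k : ℤ) (b u v : ℝ) :
    Mismatch1 δ (k * (2 * δ) + b) u v ↔ Mismatch1 δ b u v := by
  have h : ∀ u, ⌊(u + (k * (2 * δ) + b)) / δ⌋ = ⌊(u + b) / δ⌋ + 2 * k := by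
    intro u
    rw [← Int.floor_add_intCast]
    congr 1
    push_cast
    field_simp
    ring
  simp only [Mismatch1, jb, h]
  omega

lemma psiBar_le_of_le {δ : ℝ} (hδ : 0 < δ) {u v : ℝ} (huv : u ≤ v) :
    psiBar δ u v ≤ ENNReal.ofReal ((v - u - δ) / (2 * δ)) := by
  have h2δ : 0 < 2 * δ := by positivity
  have hper : volume ({b | Mismatch1 δ b u v} ∩ Set.Ioc 0 (0 + 2 * δ)) =
      volume ({b | Mismatch1 δ b u v} ∩ Set.Ioc (-u - δ) (-u - δ + 2 * δ)) := by
    refine (isAddFundamentalDomain_Ioc h2δ 0).measure_set_eq (isAddFundamentalDomain_Ioc h2δ _)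
      (measurableSet_mismatch1 δ u v) ?_
    rintro ⟨g, k, rfl⟩
    ext b
    simpa [AddSubgroup.vadd_def] using mismatch1_add_zsmul hδ k b u v
  have hsub : {b | Mismatch1 δ b u v} ∩ Set.Ioc (-u - δ) (-u - δ + 2 * δ) ⊆
      Set.Ico (2 * δ - v) (δ - u) := by
    rintro b ⟨hb, hb1, hb2⟩
    have hU : -1 < (u + b) / δ := by rw [lt_div_iff₀ hδ]; linarith
    have hU' : (u + b) / δ ≤ 1 := by rw [div_le_iff₀ hδ]; linarith
    have hV : (u + b) / δ ≤ (v + b) / δ := by gcongr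
    have hm : ⌊(u + b) / δ⌋ ≤ 1 := by
      have := (Int.floor_le ((u + b) / δ)).trans hU'
      exact_mod_cast this
    have hm' : -1 ≤ ⌊(u + b) / δ⌋ := Int.le_floor.2 (by push_cast; exact hU.le)
    have hmn : ⌊(u + b) / δ⌋ ≤ ⌊(v + b) / δ⌋ := Int.floor_le_floor hV
    have hmis : ⌊(u + b) / δ⌋ = 0 ∧ 2 ≤ ⌊(v + b) / δ⌋ := by
      simp only [Set.mem_ofPred_eq, Mismatch1, jb] at hb
      omega
    have h1 : (u + b) / δ < 1 := by
      have := Int.lt_floor_add_one ((u + b) / δ)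
      rw [hmis.1] at this
      simpa using this
    have h2 : (2 : ℝ) ≤ (v + b) / δ := by exact_mod_cast Int.le_floor.1 hmis.2
    rw [div_lt_iff₀ hδ] at h1
    rw [le_div_iff₀ hδ] at h2
    exact ⟨by linarith, by linarith⟩
  calc psiBar δ u v
      = (ENNReal.ofReal (2 * δ))⁻¹ * volume ({b | Mismatch1 δ b u v} ∩ Set.Ioo 0 (2 * δ)) := by
        rw [psiBar, unifB, Measure.smul_apply, smul_eq_mul,
          Measure.restrict_apply (measurableSet_mismatch1 δ u v)]
    _ ≤ (ENNReal.ofReal (2 * δ))⁻¹ * volume (Set.Ico (2 * δ - v) (δ - u)) := by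
        refine mul_le_mul_right ?_ _
        refine (measure_mono ?_).trans (hper.trans_le (measure_mono hsub))
        rw [zero_add]
        exact Set.inter_subset_inter_right _ Set.Ioo_subset_Ioc_self
    _ = ENNReal.ofReal ((v - u - δ) / (2 * δ)) := by
        rw [Real.volume_Ico, ENNReal.ofReal_div_of_pos h2δ, ENNReal.div_eq_inv_mul]
        congr 2
        ring

lemma psiBar_le {δ : ℝ} (hδ : 0 < δ) (u v : ℝ) :
    psiBar δ u v ≤ ENNReal.ofReal ((|u - v| - δ) / (2 * δ)) := by
  rcases le_total u v with h | h
  · rw [abs_of_nonpos (by linarith), neg_sub]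
    exact psiBar_le_of_le hδ h
  · rw [abs_of_nonneg (by linarith)]
    exact (measure_mono fun b hb => Mismatch1.symm hb).trans (psiBar_le_of_le hδ h)

/-- One-sided expected excess of a standard Gaussian over the level `δ`. -/
lemma lintegral_gaussianReal_excess_le {δ : ℝ} (hδ : 0 < δ) :
    ∫⁻ z, ENNReal.ofReal ((z - δ) / (2 * δ)) ∂gaussianReal 0 1 ≤
      ENNReal.ofReal (1 / (2 * δ ^ 3 * √(2 * π)) * rexp (-δ ^ 2 / 2)) := by
  rw [gaussianReal_of_var_ne_zero 0 one_ne_zero,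
    lintegral_withDensity_eq_lintegral_mul _ (measurable_gaussianPDF 0 1) (by fun_prop),
    ← lintegral_add_left_eq_self _ δ]
  calc _ ≤ ∫⁻ x, ENNReal.ofReal (1 / (2 * δ ^ 3 * √(2 * π)) * rexp (-δ ^ 2 / 2)) *
        gammaPDF 2 δ x := by
        refine lintegral_mono fun x => ?_
        rw [Pi.mul_apply, add_sub_cancel_left]
        rcases le_or_gt x 0 with hx | hx
        · rw [ENNReal.ofReal_of_nonpos (div_nonpos_of_nonpos_of_nonneg hx (by positivity)),
            mul_zero]
          exact zero_le
        rw [gammaPDF_of_nonneg hx.le, gaussianPDF,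
          ← ENNReal.ofReal_mul (gaussianPDFReal_nonneg _ _ _),
          ← ENNReal.ofReal_mul (by positivity)]
        apply ENNReal.ofReal_le_ofReal
        have hG : Real.Gamma 2 = 1 := Real.Gamma_two
        have hx1 : x ^ ((2 : ℝ) - 1) = x := by norm_num
        have hr : δ ^ (2 : ℝ) = δ ^ 2 := by norm_cast
        have he : rexp (-(δ + x) ^ 2 / 2) ≤ rexp (-δ ^ 2 / 2) * rexp (-(δ * x)) := by
          rw [← Real.exp_add]
          apply Real.exp_le_exp.2
          nlinarith [sq_nonneg x]
        rw [hG, hx1, hr, gaussianPDFReal]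
        simp only [NNReal.coe_one, mul_one, sub_zero]
        calc (√(2 * π))⁻¹ * rexp (-(δ + x) ^ 2 / 2) * (x / (2 * δ))
            ≤ (√(2 * π))⁻¹ * (rexp (-δ ^ 2 / 2) * rexp (-(δ * x))) * (x / (2 * δ)) := by
              gcongr
          _ = _ := by field_simp
    _ = _ := by
        rw [lintegral_const_mul' _ _ ENNReal.ofReal_ne_top,
          lintegral_gammaPDF_eq_one two_pos hδ, mul_one]

lemma lintegral_gaussianReal_abs_excess_le {δ : ℝ} (hδ : 0 < δ) :
    ∫⁻ z, ENNReal.ofReal ((|z| - δ) / (2 * δ)) ∂gaussianReal 0 1 ≤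
      ENNReal.ofReal (1 / (δ ^ 3 * √(2 * π)) * rexp (-δ ^ 2 / 2)) := by
  have hneg : ∫⁻ z, ENNReal.ofReal ((-z - δ) / (2 * δ)) ∂gaussianReal 0 1 =
      ∫⁻ z, ENNReal.ofReal ((z - δ) / (2 * δ)) ∂gaussianReal 0 1 := by
    have hmap : (gaussianReal 0 1).map (fun z => -z) = gaussianReal 0 1 := by
      rw [gaussianReal_map_neg, neg_zero]
    conv_rhs => rw [← hmap, lintegral_map (by fun_prop) (by fun_prop)]
  calc _ ≤ ∫⁻ z, (ENNReal.ofReal ((z - δ) / (2 * δ)) + ENNReal.ofReal ((-z - δ) / (2 * δ)))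
        ∂gaussianReal 0 1 := by
        refine lintegral_mono fun z => ?_
        rcases abs_choice z with hz | hz <;> rw [hz]
        · exact le_self_add
        · exact le_add_self
    _ ≤ _ := by
        rw [lintegral_add_left (by fun_prop), hneg]
        refine (add_le_add (lintegral_gaussianReal_excess_le hδ)
          (lintegral_gaussianReal_excess_le hδ)).trans_eq ?_
        rw [← ENNReal.ofReal_add (by positivity) (by positivity)]
        congr 1
        field_simp
        norm_num

lemma dotp_sub {d : ℕ} (a s q : Fin d → ℝ) : dotp a (s - q) = dotp a s - dotp a q := by
  simp [dotp, mul_sub, Finset.sum_sub_distrib]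

lemma isProbabilityMeasure_unifB {δ : ℝ} (hδ : 0 < δ) : IsProbabilityMeasure (unifB δ) := by
  refine ⟨?_⟩
  rw [unifB, Measure.smul_apply, Measure.restrict_apply_univ, Real.volume_Ioo, sub_zero,
    smul_eq_mul]
  exact ENNReal.inv_mul_cancel (by simpa using hδ) ENNReal.ofReal_ne_top

/-- Mismatch probability bound for points at distance at most `1`. -/
lemma PsiBar_le {d : ℕ} {δ : ℝ} (hδ : 0 < δ) {s q : Fin d → ℝ} (hsq : enorm' (s - q) ≤ 1) :
    PsiBar d δ s q ≤ ENNReal.ofReal (1 / (δ ^ 3 * √(2 * π)) * rexp (-δ ^ 2 / 2)) := by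
  have := isProbabilityMeasure_unifB hδ
  have hm : Measurable fun a : Fin d → ℝ => dotp a (s - q) := by unfold dotp; fun_prop
  calc PsiBar d δ s q = ∫⁻ a, psiBar δ (dotp a s) (dotp a q) ∂gaussPi d := by
        rw [PsiBar, jointμ, Measure.prod_apply (measurableSet_mismatch δ s q)]
        rfl
    _ ≤ ∫⁻ a, ENNReal.ofReal ((|dotp a (s - q)| - δ) / (2 * δ)) ∂gaussPi d := by
        refine lintegral_mono fun a => ?_
        rw [dotp_sub]
        exact psiBar_le hδ _ _
    _ = ∫⁻ x, ENNReal.ofReal ((|x| - δ) / (2 * δ)) ∂(gaussPi d).map fun a => dotp a (s - q) := by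
        rw [lintegral_map (by fun_prop) hm]
    _ = ∫⁻ z, ENNReal.ofReal ((|enorm' (s - q) * z| - δ) / (2 * δ)) ∂gaussianReal 0 1 := by
        rw [map_dotp_gaussPi, lintegral_map (by fun_prop) (by fun_prop)]
    _ ≤ ∫⁻ z, ENNReal.ofReal ((|z| - δ) / (2 * δ)) ∂gaussianReal 0 1 := by
        refine lintegral_mono fun z => ?_
        have hz : |enorm' (s - q) * z| ≤ |z| := by
          have h0 : 0 ≤ enorm' (s - q) := Real.sqrt_nonneg _
          rw [abs_mul, abs_of_nonneg h0]
          exact mul_le_of_le_one_left (abs_nonneg z) hsq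
        gcongr
    _ ≤ _ := lintegral_gaussianReal_abs_excess_le hδ

/-- with `w` independent hash draws and
`w (1/(δ³√(2π))) e^{-δ²/2} ≤ ε`, any two points at distance at most 1 have all `w`
ternary hashes matching with probability at least `1 - ε`. -/
theorem no_false_negative (d : ℕ) (hd : 1 ≤ d) (δ : ℝ) (hδ : 0 < δ) (w : ℕ) (hw : 1 ≤ w)
    (ε : ℝ) (hε : 0 < ε)
    (h : (w : ℝ) * (1 / (δ ^ 3 * Real.sqrt (2 * π)) * Real.exp (-δ ^ 2 / 2)) ≤ ε)
    (s q : Fin d → ℝ) (hsq : enorm' (s - q) ≤ 1) :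
    1 - ENNReal.ofReal ε ≤
      (Measure.pi fun _ : Fin w => jointμ d δ)
        {ω | ∀ i, ¬ Mismatch δ (ω i).1 (ω i).2 s q} := by
  have := isProbabilityMeasure_unifB hδ
  have : IsProbabilityMeasure (gaussPi d) := by unfold gaussPi; infer_instance
  have : IsProbabilityMeasure (jointμ d δ) := by unfold jointμ; infer_instance
  set M : Set ((Fin d → ℝ) × ℝ) := {ab | Mismatch δ ab.1 ab.2 s q} with hM
  set P := Measure.pi fun _ : Fin w => jointμ d δ with hP
  have hMm : MeasurableSet M := measurableSet_mismatch δ s q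
  have hset : {ω : Fin w → (Fin d → ℝ) × ℝ | ∀ i, ¬ Mismatch δ (ω i).1 (ω i).2 s q} =
      (⋃ i, Function.eval i ⁻¹' M)ᶜ := by
    ext ω
    simp [hM]
  have hbad : P (⋃ i, Function.eval i ⁻¹' M) ≤ ENNReal.ofReal ε :=
    calc P (⋃ i, Function.eval i ⁻¹' M) ≤ ∑ i : Fin w, P (Function.eval i ⁻¹' M) :=
          measure_iUnion_fintype_le _ _
      _ = w * PsiBar d δ s q := by
          have hi : ∀ i : Fin w, P (Function.eval i ⁻¹' M) = PsiBar d δ s q := fun i =>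
            (measurePreserving_eval (fun _ : Fin w => jointμ d δ) i).measure_preimage
              hMm.nullMeasurableSet
          simp [hi]
      _ ≤ w * ENNReal.ofReal (1 / (δ ^ 3 * √(2 * π)) * rexp (-δ ^ 2 / 2)) := by
          gcongr
          exact PsiBar_le hδ hsq
      _ ≤ ENNReal.ofReal ε := by
          rw [← ENNReal.ofReal_natCast, ← ENNReal.ofReal_mul (by positivity)]
          exact ENNReal.ofReal_le_ofReal h
  rw [hset, prob_compl_eq_one_sub (MeasurableSet.iUnion fun i => measurable_pi_apply i hMm)]
  exact tsub_le_tsub_left hbad 1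

end
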